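/- arXiv:1308.4769 — 6 statements merged into one kernel-verified Lean document; each statement's English description precedes it below -/
import Mathlib

section
/- For every positive integer n, every q ∈ ℂ, and all z_1, …, z_n ∈ ℂ, the antisymmetrization identity ∑_{σ∈S_n} sgn(σ) ∏_{1≤i<j≤n} (z_{σ(j)} - q z_{σ(i)} - (1-q) z_{σ(i)} z_{σ(j)}) = [n]_q! ∏_{1≤i<j≤n} (z_j - z_i) holds. -/
open Finset

/-- The `q`-integer `[k]_q = 1 + q + ⋯ + q^(k-1)`. -/
noncomputable def qnum (q : ℂ) (k : ℕ) : ℂ := ∑ i ∈ Finset.range k, q ^ i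

/-- The `q`-factorial `[n]_q! = ∏_{k=1}^n [k]_q`. -/
noncomputable def qfact (q : ℂ) (n : ℕ) : ℂ := ∏ k ∈ Finset.range n, qnum q (k + 1)

/-- Lagrange interpolation of `∏ y ∈ s, (X - q * y)` at the nodes `insert 0 s`. -/
theorem one_sub_mul_sum_prod_div_sub (q : ℂ) (s : Finset ℂ) (hs : (0 : ℂ) ∉ s) :
    (1 - q) * ∑ x ∈ s, ∏ y ∈ s.erase x, (x - q * y) / (x - y) = 1 - q ^ #s := by
  set P : Polynomial ℂ := ∏ y ∈ s, (Polynomial.X - Polynomial.C (q * y)) with hP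
  have hmonic : P.Monic := Polynomial.monic_prod_of_monic _ _ fun y _ =>
    Polynomial.monic_X_sub_C _
  have hdeg : P.natDegree = #s := by
    rw [hP, Polynomial.natDegree_prod_of_monic _ _ fun y _ => Polynomial.monic_X_sub_C _]
    simp only [Polynomial.natDegree_X_sub_C, sum_const, smul_eq_mul, mul_one]
  have hlead := Lagrange.leadingCoeff_eq_sum (s := insert 0 s) (v := id) (P := P)
    Function.injective_id.injOn (by
      rw [Polynomial.degree_eq_natDegree hmonic.ne_zero, hdeg, card_insert_of_notMem hs]
      rfl)
  have heval (x : ℂ) : P.eval x = ∏ y ∈ s, (x - q * y) := by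
    simp [hP, Polynomial.eval_prod]
  have hne : ∀ y ∈ s, y ≠ 0 := fun y hy h => hs (h ▸ hy)
  rw [hmonic.leadingCoeff, sum_insert hs, erase_insert hs] at hlead
  have hzero : P.eval (id 0) / ∏ y ∈ s, (id 0 - id y) = q ^ #s := by
    rw [heval, ← prod_div_distrib, ← prod_const]
    refine prod_congr rfl fun y hy => ?_
    have := hne y hy
    simp only [id]
    field_simp
    ring
  rw [hzero] at hlead
  rw [eq_sub_iff_add_eq', mul_sum]
  refine Eq.trans ?_ hlead.symm
  congr 1
  refine sum_congr rfl fun x hx => ?_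
  have h0 : x ≠ 0 := hne x hx
  rw [erase_insert_of_ne h0.symm, prod_insert (by simp [hs]), heval,
    ← mul_prod_erase _ _ hx, prod_div_distrib]
  simp only [id, sub_zero]
  rw [show x - q * x = x * (1 - q) by ring, mul_assoc, mul_div_mul_left _ _ h0, mul_div_assoc]

theorem sum_prod_div_sub_eq_qnum {n : ℕ} {q : ℂ} (hq : 1 - q ≠ 0) {z : Fin n → ℂ}
    (hz : Function.Injective z) (h0 : ∀ i, z i ≠ 0) (h1 : ∀ i, 1 - z i ≠ 0) :
    ∑ m, ∏ j ∈ univ.erase m,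
      (z j - q * z m - (1 - q) * z m * z j) / (z j - z m) = qnum q n := by
  have hinj : Function.Injective fun i => (1 - z i) / z i := by
    intro i j hij
    have hi := h0 i
    have hj := h0 j
    simp only at hij
    field_simp at hij
    exact hz (by linear_combination -hij)
  obtain ⟨u, hu⟩ : ∃ u : Fin n ↪ ℂ, ∀ i, u i = (1 - z i) / z i := ⟨⟨_, hinj⟩, fun _ => rfl⟩
  have key := one_sub_mul_sum_prod_div_sub q (univ.map u) (by simp [hu, h0, h1])
  simp only [sum_map, ← map_erase, prod_map, card_map, card_univ, Fintype.card_fin] at key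
  simp only [hu] at key
  have hgeom : (1 - q) * qnum q n = 1 - q ^ n := mul_neg_geom_sum q n
  rw [← hgeom] at key
  rw [← mul_left_cancel₀ hq key]
  refine sum_congr rfl fun m _ => prod_congr rfl fun j hj => ?_
  have hm := h0 m
  have hj0 := h0 j
  have hne : z j - z m ≠ 0 := sub_ne_zero.2 fun h => (mem_erase.1 hj).1 (hz h)
  have hne' : (1 - z m) / z m - (1 - z j) / z j ≠ 0 :=
    sub_ne_zero.2 fun h => (mem_erase.1 hj).1 (hinj h).symm
  rw [div_eq_div_iff hne hne']
  field_simp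
  ring

theorem Fin.prod_prod_Ioi_succ {M : Type*} [CommMonoid M] {n : ℕ}
    (f : Fin (n + 1) → Fin (n + 1) → M) :
    ∏ i, ∏ j ∈ Ioi i, f i j =
      (∏ j : Fin n, f 0 j.succ) * ∏ i : Fin n, ∏ j ∈ Ioi i, f i.succ j.succ := by
  simp only [Fin.prod_univ_succ, Fin.prod_Ioi_zero, Fin.prod_Ioi_succ]

theorem Fin.prod_swap_zero_succ {M : Type*} [CommMonoid M] {n : ℕ} (m : Fin (n + 1))
    (f : Fin (n + 1) → M) :
    ∏ j : Fin n, f (Equiv.swap 0 m j.succ) = ∏ j ∈ univ.erase m, f j := by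
  have h : (univ.erase (0 : Fin (n + 1))).map (Equiv.swap 0 m).toEmbedding = univ.erase m := by
    rw [map_erase]
    simp
  rw [← h, prod_map, ← Fin.prod_Ioi_zero fun j => f (Equiv.swap 0 m j)]
  refine prod_congr ?_ fun _ _ => rfl
  ext i
  simp

theorem antisymmetrization_identity_of_generic (n : ℕ) {q : ℂ} (hq : 1 - q ≠ 0) {z : Fin n → ℂ}
    (hz : Function.Injective z) (h0 : ∀ i, z i ≠ 0) (h1 : ∀ i, 1 - z i ≠ 0) :
    ∑ σ : Equiv.Perm (Fin n), ((Equiv.Perm.sign σ : ℤ) : ℂ) *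
        ∏ i, ∏ j ∈ Ioi i, (z (σ j) - q * z (σ i) - (1 - q) * z (σ i) * z (σ j))
      = qfact q n * ∏ i, ∏ j ∈ Ioi i, (z j - z i) := by
  induction n with
  | zero => simp [qfact]
  | succ n ih =>
    rw [← Equiv.Perm.decomposeFin.symm.sum_comp, Fintype.sum_prod_type]
    have hterm (m : Fin (n + 1)) :
        ∑ e : Equiv.Perm (Fin n),
          ((Equiv.Perm.sign (Equiv.Perm.decomposeFin.symm (m, e)) : ℤ) : ℂ) *
            ∏ i, ∏ j ∈ Ioi i, (z (Equiv.Perm.decomposeFin.symm (m, e) j)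
              - q * z (Equiv.Perm.decomposeFin.symm (m, e) i)
              - (1 - q) * z (Equiv.Perm.decomposeFin.symm (m, e) i)
                * z (Equiv.Perm.decomposeFin.symm (m, e) j))
        = (∏ j ∈ univ.erase m, (z j - q * z m - (1 - q) * z m * z j) / (z j - z m)) *
          (qfact q n * ∏ i, ∏ j ∈ Ioi i, (z j - z i)) := by
      have hih := ih (z := fun i => z (Equiv.swap 0 m i.succ))
        (hz.comp ((Equiv.swap 0 m).injective.comp (Fin.succ_injective n)))
        (fun i => h0 _) (fun i => h1 _)
      have hvand := (Equiv.swap 0 m).prod_Ioi_comp_eq_sign_mul_prod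
        (f := fun i j => z j - z i) (by simp)
      rw [Fin.prod_prod_Ioi_succ, Equiv.swap_apply_left,
        Fin.prod_swap_zero_succ m fun j => z j - z m] at hvand
      have hne : ∏ j ∈ univ.erase m, (z j - z m) ≠ 0 :=
        prod_ne_zero_iff.2 fun j hj => sub_ne_zero.2 fun h => (mem_erase.1 hj).1 (hz h)
      have hsign : ((Equiv.Perm.sign (Equiv.swap 0 m) : ℤ) : ℂ) *
          ((Equiv.Perm.sign (Equiv.swap 0 m) : ℤ) : ℂ) = 1 := by
        rw [← Int.cast_mul, Int.units_coe_mul_self, Int.cast_one]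
      have hdecomp (e : Equiv.Perm (Fin n)) :
          Equiv.Perm.sign (Equiv.Perm.decomposeFin.symm (m, e)) =
            Equiv.Perm.sign (Equiv.swap 0 m) * Equiv.Perm.sign e := by
        rw [Equiv.Perm.decomposeFin.symm_sign, Equiv.Perm.sign_swap']
        simp only [eq_comm]
      have hfirst (e : Equiv.Perm (Fin n)) :
          ∏ j : Fin n, (z (Equiv.swap 0 m (e j).succ) - q * z m
              - (1 - q) * z m * z (Equiv.swap 0 m (e j).succ))
            = ∏ j ∈ univ.erase m, (z j - q * z m - (1 - q) * z m * z j) := by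
        rw [← Fin.prod_swap_zero_succ m fun j => z j - q * z m - (1 - q) * z m * z j]
        exact Equiv.prod_comp e fun j : Fin n => z (Equiv.swap 0 m j.succ) - q * z m
              - (1 - q) * z m * z (Equiv.swap 0 m j.succ)
      simp only [Fin.prod_prod_Ioi_succ, Equiv.Perm.decomposeFin_symm_apply_zero,
        Equiv.Perm.decomposeFin_symm_apply_succ, hfirst, hdecomp, Units.val_mul, Int.cast_mul]
      rw [← Fin.prod_prod_Ioi_succ fun i j => z j - z i, prod_div_distrib]
      set A := ∏ j ∈ univ.erase m, (z j - q * z m - (1 - q) * z m * z j)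
      set s := ((Equiv.Perm.sign (Equiv.swap 0 m) : ℤ) : ℂ)
      simp only [mul_assoc, mul_left_comm _ A, ← mul_sum] at hih ⊢
      rw [hih, div_mul_eq_mul_div, eq_div_iff hne]
      linear_combination (A * s * qfact q n) * hvand +
        (A * qfact q n * ∏ i, ∏ j ∈ Ioi i, (z j - z i)) * hsign
    rw [sum_congr rfl fun m _ => hterm m, ← sum_mul, sum_prod_div_sub_eq_qnum hq hz h0 h1,
      qfact, qfact, prod_range_succ]
    ring

theorem eventually_add_mul_ne_zero (a : ℂ) {b : ℂ} (hb : b ≠ 0) :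
    ∀ᶠ t in nhdsWithin (0 : ℂ) {0}ᶜ, a + b * t ≠ 0 := by
  have hfin : {t : ℂ | a + b * t = 0}.Finite :=
    (Set.finite_singleton (-a / b)).subset fun t ht => by
      simp only [Set.mem_ofPred_eq] at ht
      rw [Set.mem_singleton_iff, eq_div_iff hb]
      linear_combination ht
  exact nhdsNE_le_cofinite 0 hfin.compl_mem_cofinite

/-- For every positive integer `n`, every `q ∈ ℂ` and all
`z_1, …, z_n ∈ ℂ`,
`∑_{σ∈S_n} sgn(σ) ∏_{1≤i<j≤n} (z_{σ(j)} - q z_{σ(i)} - (1-q) z_{σ(i)} z_{σ(j)})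
  = [n]_q! ∏_{1≤i<j≤n} (z_j - z_i)`. -/
theorem antisymmetrization_identity (n : ℕ) (hn : 0 < n) (q : ℂ) (z : Fin n → ℂ) :
    ∑ σ : Equiv.Perm (Fin n),
      ((Equiv.Perm.sign σ : ℤ) : ℂ) *
        ∏ p ∈ Finset.univ.filter (fun p : Fin n × Fin n => p.1 < p.2),
          (z (σ p.2) - q * z (σ p.1) - (1 - q) * z (σ p.1) * z (σ p.2))
      = qfact q n *
          ∏ p ∈ Finset.univ.filter (fun p : Fin n × Fin n => p.1 < p.2),
            (z p.2 - z p.1) := by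
  have hpairs (f : Fin n → Fin n → ℂ) :
      ∏ p ∈ univ.filter (fun p : Fin n × Fin n => p.1 < p.2), f p.1 p.2 =
        ∏ i, ∏ j ∈ Ioi i, f i j :=
    prod_finset_product' _ _ _ (by simp)
  rw [hpairs fun i j => z j - z i]
  simp only [fun σ : Equiv.Perm (Fin n) => hpairs fun i j =>
    z (σ j) - q * z (σ i) - (1 - q) * z (σ i) * z (σ j)]
  -- Perturb `q` and `z` linearly in `t` to a generic position, then let `t` tend to `0`.
  let Q : ℂ → ℂ := fun t => q + t
  let Z : ℂ → Fin n → ℂ := fun t i => z i + ((i : ℕ) + 1) * t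
  have hpos (i : Fin n) : ((i : ℕ) : ℂ) + 1 ≠ 0 := Nat.cast_add_one_ne_zero _
  have hgen : ∀ᶠ t in nhdsWithin (0 : ℂ) {0}ᶜ,
      ∑ σ : Equiv.Perm (Fin n), ((Equiv.Perm.sign σ : ℤ) : ℂ) *
        ∏ i, ∏ j ∈ Ioi i, (Z t (σ j) - Q t * Z t (σ i) - (1 - Q t) * Z t (σ i) * Z t (σ j))
      = qfact (Q t) n * ∏ i, ∏ j ∈ Ioi i, (Z t j - Z t i) := by
    have hq := eventually_add_mul_ne_zero (1 - q) (neg_ne_zero.2 one_ne_zero)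
    have h0 := Filter.eventually_all.2 fun i => eventually_add_mul_ne_zero (z i) (hpos i)
    have h1 := Filter.eventually_all.2 fun i =>
      eventually_add_mul_ne_zero (1 - z i) (neg_ne_zero.2 (hpos i))
    have hinj : ∀ᶠ t in nhdsWithin (0 : ℂ) {0}ᶜ, ∀ i j : Fin n, i ≠ j → Z t i ≠ Z t j := by
      simp only [Filter.eventually_all]
      intro i j hij
      have hb : ((i : ℕ) : ℂ) - (j : ℕ) ≠ 0 :=
        sub_ne_zero.2 fun h => hij (Fin.ext (Nat.cast_injective h))
      filter_upwards [eventually_add_mul_ne_zero (z i - z j) hb] with t ht h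
      exact ht (by linear_combination h)
    filter_upwards [hq, h0, h1, hinj] with t hq h0 h1 hinj
    refine antisymmetrization_identity_of_generic n (fun h => hq ?_)
      (fun i j h => by_contra fun hij => hinj i j hij h) h0 (fun i h => h1 i ?_)
    · linear_combination h
    · linear_combination h
  have hlim := tendsto_nhds_unique_of_eventuallyEq
    (Continuous.tendsto' (by fun_prop) 0 _ rfl |>.mono_left nhdsWithin_le_nhds)
    (Continuous.tendsto' (by unfold qfact qnum; fun_prop) 0 _ rfl
      |>.mono_left nhdsWithin_le_nhds) hgen
  simpa [Q, Z] using hlim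
end

section
/- Let q ∈ ℂ, N ≥ 2, and let u : ℤ^N → ℂ (arguments written u(x_N, …, x_1)) satisfy the boundary relation: for every 2 ≤ i ≤ N, every a ∈ ℤ, and all other arguments fixed, u(x_N, …, x_{i+1}, a, a-1, x_{i-2}, …, x_1) = q·u(x_N, …, x_{i+1}, a-1, a, x_{i-2}, …, x_1) - (q-1)·u(x_N, …, x_{i+1}, a, a, x_{i-2}, …, x_1), the displayed pair occupying the i-th and (i-1)-th rightmost slots. Fix K ≥ 0 and n ≥ 1 with K + n ≤ N, fix x ∈ ℤ, and let X = (x_N, …, x_1) ∈ ℤ^N satisfy x_{K+1} = ⋯ = x_{K+n} = x. For 1 ≤ i ≤ n, let X_i denote X with its (K+n-i+1)-th rightmost coordinate replaced by x - 1. Then u(X_i) = q^{i-1} u(X_1) - (q^{i-1} - 1) u(X) for every 1 ≤ i ≤ n. -/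
/-- The boundary relation for `u : ℤ^N → ℂ` (arguments written `u(x_N, …, x_1)`,
with the `i`-th rightmost coordinate stored at index `i - 1`): for every
`2 ≤ i ≤ N` and `a ∈ ℤ`,
`u(…, a, a-1, …) = q·u(…, a-1, a, …) - (q-1)·u(…, a, a, …)`,
the displayed pair occupying the `i`-th and `(i-1)`-th rightmost slots
(indices `j+1` and `j` below, where `j = i - 2`). -/
def BoundaryRel (q : ℂ) (N : ℕ) (u : (Fin N → ℤ) → ℂ) : Prop :=
  ∀ (X : Fin N → ℤ) (j : ℕ) (hj : j + 1 < N) (a : ℤ),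
    u (Function.update (Function.update X ⟨j + 1, hj⟩ a) ⟨j, by omega⟩ (a - 1)) =
      q * u (Function.update (Function.update X ⟨j + 1, hj⟩ (a - 1)) ⟨j, by omega⟩ a)
        - (q - 1) *
            u (Function.update (Function.update X ⟨j + 1, hj⟩ a) ⟨j, by omega⟩ a)

/-- One application of the boundary relation at two adjacent equal coordinates. -/
theorem BoundaryRel.update_sub_one {q : ℂ} {N : ℕ} {u : (Fin N → ℤ) → ℂ}
    (hu : BoundaryRel q N u) {x : ℤ} (X : Fin N → ℤ) (j : ℕ) (hj : j + 1 < N)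
    (h₀ : X ⟨j, by omega⟩ = x) (h₁ : X ⟨j + 1, hj⟩ = x) :
    u (Function.update X ⟨j, by omega⟩ (x - 1)) =
      q * u (Function.update X ⟨j + 1, hj⟩ (x - 1)) - (q - 1) * u X := by
  have hne : (⟨j, by omega⟩ : Fin N) ≠ ⟨j + 1, hj⟩ := by simp
  have hself₁ : Function.update X ⟨j + 1, hj⟩ x = X := by
    rw [← h₁, Function.update_eq_self]
  have hself₀ : Function.update X ⟨j, by omega⟩ x = X := by
    rw [← h₀, Function.update_eq_self]
  have h := hu X j hj x
  rwa [hself₁, hself₀, Function.update_comm hne.symm, hself₀] at h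

/-- Lemma 1 of the paper.  Let `u : ℤ^N → ℂ` satisfy the boundary
relation.  Fix `K ≥ 0`, `n ≥ 1` with `K + n ≤ N`, `x ∈ ℤ`, and let
`X = (x_N, …, x_1)` satisfy `x_{K+1} = ⋯ = x_{K+n} = x`.  For `1 ≤ i ≤ n`, let `X_i`
denote `X` with its `(K+n-i+1)`-th rightmost coordinate replaced by `x - 1`.  Then
`u(X_i) = q^{i-1} u(X_1) - (q^{i-1} - 1) u(X)` for every `1 ≤ i ≤ n`. -/
theorem boundary_iterate (q : ℂ) (N : ℕ) (hN : 2 ≤ N) (u : (Fin N → ℤ) → ℂ)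
    (hu : BoundaryRel q N u) (K n : ℕ) (hn : 1 ≤ n) (hKn : K + n ≤ N) (x : ℤ)
    (X : Fin N → ℤ)
    (hX : ∀ (l : ℕ) (hl : l < N), K ≤ l → l < K + n → X ⟨l, hl⟩ = x)
    (i : ℕ) (hi1 : 1 ≤ i) (hin : i ≤ n) :
    u (Function.update X ⟨K + n - i, by omega⟩ (x - 1)) =
      q ^ (i - 1) * u (Function.update X ⟨K + n - 1, by omega⟩ (x - 1))
        - (q ^ (i - 1) - 1) * u X := by
  induction i, hi1 using Nat.le_induction with
  | base => simp
  | succ i hi ih =>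
    have hstep := hu.update_sub_one X (K + n - (i + 1)) (by omega)
      (hX _ (by omega) (by omega) (by omega)) (hX _ (by omega) (by omega) (by omega))
    have hidx : K + n - (i + 1) + 1 = K + n - i := by omega
    simp only [hidx] at hstep
    obtain ⟨m, rfl⟩ := Nat.exists_eq_add_of_le' hi
    rw [hstep, ih (by omega)]
    simp only [Nat.add_sub_cancel]
    ring
end

section
/- Let q ∈ ℂ, N ≥ 2, and let z_1, …, z_N be nonzero complex numbers such that z_α - q z_β - (1-q) z_α z_β ≠ 0 for all α ≠ β. Define u : ℤ^N → ℂ by u(x_N, …, x_1) = ∑_{σ ∈ S_N} A_σ ∏_{i=1}^N z_{σ(i)}^{x_i}. Then u satisfies the boundary relation: for every 2 ≤ i ≤ N, every a ∈ ℤ, and all other arguments fixed, u(x_N, …, x_{i+1}, a, a-1, x_{i-2}, …, x_1) = q·u(x_N, …, x_{i+1}, a-1, a, x_{i-2}, …, x_1) - (q-1)·u(x_N, …, x_{i+1}, a, a, x_{i-2}, …, x_1), the displayed pair occupying the i-th and (i-1)-th rightmost slots. -/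
open Finset

/-- The two-particle `S`-matrix
`S_{βα}(z_α, z_β) = -(z_β - q z_α - (1-q) z_α z_β)/(z_α - q z_β - (1-q) z_α z_β)`. -/
noncomputable def Smat (q za zb : ℂ) : ℂ :=
  -(zb - q * za - (1 - q) * za * zb) / (za - q * zb - (1 - q) * za * zb)

/-- `A_σ = ∏_{(α,β)} S_{βα}(z_α, z_β)`, the product over all inversions of `σ`. -/
noncomputable def Acoef (q : ℂ) {n : ℕ} (σ : Equiv.Perm (Fin n)) (z : Fin n → ℂ) : ℂ :=
  ∏ p ∈ Finset.univ.filter (fun p : Fin n × Fin n => p.1 < p.2 ∧ σ p.2 < σ p.1),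
    Smat q (z (σ p.2)) (z (σ p.1))

/-- An adjacent transposition preserves the order of every increasing pair but the one it swaps. -/
theorem swap_lt_swap_of_adjacent {n : ℕ} {j k : Fin n} (hjk : (k : ℕ) = j + 1) {a b : Fin n}
    (hab : a < b) (hne : ¬(a = j ∧ b = k)) : Equiv.swap j k a < Equiv.swap j k b := by
  simp only [Equiv.swap_apply_def]
  split_ifs <;> simp only [Fin.lt_def, Fin.ext_iff] at * <;> omega

/-- Composing with an ascending adjacent transposition creates exactly one inversion. -/
theorem Acoef_mul_swap (q : ℂ) {n : ℕ} (σ : Equiv.Perm (Fin n)) (z : Fin n → ℂ) {j k : Fin n}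
    (hjk : (k : ℕ) = j + 1) (hσ : σ j < σ k) :
    Acoef q (σ * Equiv.swap j k) z = Smat q (z (σ j)) (z (σ k)) * Acoef q σ z := by
  have hlt : j < k := by simp only [Fin.lt_def]; omega
  have hmem : (j, k) ∈ univ.filter (fun p : Fin n × Fin n =>
      p.1 < p.2 ∧ (σ * Equiv.swap j k) p.2 < (σ * Equiv.swap j k) p.1) := by
    exact mem_filter.2 ⟨mem_univ _, hlt, by simpa using hσ⟩
  unfold Acoef
  rw [← mul_prod_erase _ _ hmem]
  congr 1
  · simp
  · refine prod_nbij' (fun p => (Equiv.swap j k p.1, Equiv.swap j k p.2))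
      (fun p => (Equiv.swap j k p.1, Equiv.swap j k p.2)) ?_ ?_ ?_ ?_ ?_
    · rintro ⟨a, b⟩ h
      simp only [mem_erase, ne_eq, Prod.mk.injEq, mem_filter, mem_univ, true_and] at h ⊢
      simp only [Equiv.Perm.mul_apply] at h
      exact ⟨swap_lt_swap_of_adjacent hjk h.2.1 h.1, h.2.2⟩
    · rintro ⟨a, b⟩ h
      simp only [mem_erase, ne_eq, Prod.mk.injEq, mem_filter, mem_univ, true_and] at h ⊢
      simp only [Equiv.Perm.mul_apply, Equiv.swap_apply_self]
      refine ⟨?_, swap_lt_swap_of_adjacent hjk h.1 ?_, h.2⟩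
      · rintro ⟨ha, hb⟩
        rw [Equiv.swap_apply_eq_iff, Equiv.swap_apply_left] at ha
        rw [Equiv.swap_apply_eq_iff, Equiv.swap_apply_right] at hb
        exact absurd (ha ▸ hb ▸ h.1) hlt.asymm
      · rintro ⟨rfl, rfl⟩
        exact absurd h.2 hσ.asymm
    · simp
    · simp
    · simp

/-- The exchange relation between the coefficients of `σ` and `σ ∘ (j k)`, `k = j + 1`. -/
theorem Acoef_exchange (q : ℂ) {n : ℕ} (z : Fin n → ℂ)
    (hden : ∀ a b : Fin n, a ≠ b → z a - q * z b - (1 - q) * z a * z b ≠ 0)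
    (σ : Equiv.Perm (Fin n)) {j k : Fin n} (hjk : (k : ℕ) = j + 1) :
    Acoef q σ z * (z (σ k) - q * z (σ j) - (1 - q) * z (σ j) * z (σ k)) +
      Acoef q (σ * Equiv.swap j k) z *
        (z (σ j) - q * z (σ k) - (1 - q) * z (σ j) * z (σ k)) = 0 := by
  have ascending (τ : Equiv.Perm (Fin n)) (hτ : τ j < τ k) :
      Acoef q τ z * (z (τ k) - q * z (τ j) - (1 - q) * z (τ j) * z (τ k)) +
        Acoef q (τ * Equiv.swap j k) z *
          (z (τ j) - q * z (τ k) - (1 - q) * z (τ j) * z (τ k)) = 0 := by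
    rw [Acoef_mul_swap q τ z hjk hτ, Smat]
    linear_combination Acoef q τ z *
      div_mul_cancel₀ (-(z (τ k) - q * z (τ j) - (1 - q) * z (τ j) * z (τ k))) (hden _ _ hτ.ne)
  have hne : σ j ≠ σ k := fun h => by
    have := congrArg Fin.val (σ.injective h)
    omega
  rcases hne.lt_or_gt with h | h
  · exact ascending σ h
  · have := ascending (σ * Equiv.swap j k) (by simpa using h)
    simp only [mul_assoc, Equiv.swap_mul_self, mul_one, Equiv.Perm.mul_apply,
      Equiv.swap_apply_left, Equiv.swap_apply_right] at this
    linear_combination this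

theorem prod_zpow_update_update {n : ℕ} (w : Fin n → ℂ) (X : Fin n → ℤ) {j k : Fin n}
    (hjk : j ≠ k) (a b : ℤ) :
    ∏ i, w i ^ (Function.update (Function.update X k a) j b i) =
      w j ^ b * (w k ^ a * ∏ i ∈ (univ.erase j).erase k, w i ^ X i) := by
  rw [← mul_prod_erase univ _ (mem_univ j),
    ← mul_prod_erase (univ.erase j) _ (mem_erase.2 ⟨hjk.symm, mem_univ k⟩)]
  congr 1
  · simp
  · congr 1
    · simp [hjk.symm]
    · refine prod_congr rfl fun i hi => ?_
      simp only [mem_erase, mem_univ, and_true] at hi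
      simp [hi.1, hi.2]

/-- Let `z_1, …, z_N` be nonzero complex numbers with
`z_α - q z_β - (1-q) z_α z_β ≠ 0` for all `α ≠ β`.  Then the Bethe ansatz function
`u(x_N, …, x_1) = ∑_{σ ∈ S_N} A_σ ∏_{i=1}^N z_{σ(i)}^{x_i}` satisfies the boundary
relation. -/
theorem bethe_satisfies_boundary (q : ℂ) (N : ℕ) (hN : 2 ≤ N) (z : Fin N → ℂ)
    (hz : ∀ i, z i ≠ 0)
    (hden : ∀ a b : Fin N, a ≠ b → z a - q * z b - (1 - q) * z a * z b ≠ 0) :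
    BoundaryRel q N
      (fun X => ∑ σ : Equiv.Perm (Fin N), Acoef q σ z * ∏ i, z (σ i) ^ (X i)) := by
  intro X j hj a
  obtain ⟨k, hk⟩ : ∃ k : Fin N, k = ⟨j + 1, hj⟩ := ⟨_, rfl⟩
  obtain ⟨l, hl⟩ : ∃ l : Fin N, l = ⟨j, by omega⟩ := ⟨_, rfl⟩
  have hlk : (k : ℕ) = l + 1 := by simp [hk, hl]
  have hne : l ≠ k := fun h => by
    have := congrArg Fin.val h
    omega
  rw [← hk, ← hl]
  simp only [prod_zpow_update_update (fun i => z (_ : Fin N)) X hne]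
  rw [← sub_eq_zero, mul_sum, mul_sum, ← sum_sub_distrib, ← sum_sub_distrib]
  refine sum_involution (fun σ _ => σ * Equiv.swap l k) ?_ ?_ (fun _ _ => mem_univ _) ?_
  · intro σ _
    have hrest : ∏ i ∈ (univ.erase l).erase k, z ((σ * Equiv.swap l k) i) ^ X i =
        ∏ i ∈ (univ.erase l).erase k, z (σ i) ^ X i := by
      refine prod_congr rfl fun i hi => ?_
      simp only [mem_erase, mem_univ, and_true] at hi
      rw [Equiv.Perm.mul_apply, Equiv.swap_apply_of_ne_of_ne hi.2 hi.1]
    rw [hrest]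
    simp only [Equiv.Perm.mul_apply, Equiv.swap_apply_left, Equiv.swap_apply_right]
    have hpow (i : Fin N) : z i ^ a = z i ^ (a - 1) * z i := by
      rw [← zpow_add_one₀ (hz i), sub_add_cancel]
    rw [hpow (σ l), hpow (σ k)]
    linear_combination (z (σ l) ^ (a - 1) * z (σ k) ^ (a - 1) *
      ∏ i ∈ (univ.erase l).erase k, z (σ i) ^ X i) * Acoef_exchange q z hden σ hlk
  · intro σ _ _ h
    exact hne (Equiv.swap_eq_one_iff.1 (mul_eq_left.1 h))
  · intro σ _
    simp [mul_assoc]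
end

section
/- Let q ∈ ℂ, N ≥ 1, and let z_1, …, z_N be nonzero complex numbers such that z_α - q z_β - (1-q) z_α z_β ≠ 0 for all α ≠ β. Define u : ℤ^N × ℝ → ℂ by u(x_N, …, x_1; t) = ∑_{σ ∈ S_N} A_σ ∏_{i=1}^N z_{σ(i)}^{x_i} e^{ε(z_{σ(i)}) t}, where ε(z) = 1/z - 1. Then for every X = (x_N, …, x_1) ∈ ℤ^N and every t ∈ ℝ, the time derivative satisfies (d/dt) u(X; t) = ∑_{i=1}^N u(x_N, …, x_{i+1}, x_i - 1, x_{i-1}, …, x_1; t) - N·u(X; t); that is, u solves the free evolution equation of the N-particle totally asymmetric zero range process. -/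
open Finset

/-- A product of plane waves with weights `w i` has logarithmic time derivative
`∑ i, ((w i)⁻¹ - 1)`. -/
theorem hasDerivAt_prod_planeWave {ι : Type*} [Fintype ι] (w : ι → ℂ) (X : ι → ℤ) (t : ℝ) :
    HasDerivAt (fun s : ℝ => ∏ i, w i ^ X i * Complex.exp (((w i)⁻¹ - 1) * s))
      ((∑ i, ((w i)⁻¹ - 1)) * ∏ i, w i ^ X i * Complex.exp (((w i)⁻¹ - 1) * t)) t := by
  have hexp (s : ℝ) : ∏ i, w i ^ X i * Complex.exp (((w i)⁻¹ - 1) * s) =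
      (∏ i, w i ^ X i) * Complex.exp ((∑ i, ((w i)⁻¹ - 1)) * s) := by
    rw [prod_mul_distrib, sum_mul, Complex.exp_sum]
  simp only [hexp]
  have h := ((((hasDerivAt_id (t : ℂ)).const_mul (∑ i, ((w i)⁻¹ - 1))).cexp).const_mul
    (∏ i, w i ^ X i)).comp_ofReal
  simp only [id_eq, mul_one] at h
  convert h using 1
  ring

/-- Lowering the `i`-th coordinate divides a product of plane waves by `w i`. -/
theorem prod_planeWave_update {ι : Type*} [Fintype ι] [DecidableEq ι] (w : ι → ℂ)
    (hw : ∀ i, w i ≠ 0) (X : ι → ℤ) (f : ι → ℂ) (i : ι) :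
    ∏ j, w j ^ Function.update X i (X i - 1) j * f j = (w i)⁻¹ * ∏ j, w j ^ X j * f j := by
  rw [← mul_prod_erase univ _ (mem_univ i),
    ← mul_prod_erase univ (fun j => w j ^ X j * f j) (mem_univ i), Function.update_self,
    zpow_sub_one₀ (hw i)]
  rw [prod_congr rfl fun j hj => by rw [Function.update_of_ne (ne_of_mem_erase hj)]]
  ring

/-- Let `z_1, …, z_N` be nonzero complex numbers with
`z_α - q z_β - (1-q) z_α z_β ≠ 0` for all `α ≠ β`, and let
`u(x_N, …, x_1; t) = ∑_{σ ∈ S_N} A_σ ∏_{i=1}^N z_{σ(i)}^{x_i} e^{ε(z_{σ(i)}) t}`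
with `ε(z) = 1/z - 1`.  Then for every `X ∈ ℤ^N` and `t ∈ ℝ`,
`(d/dt) u(X; t) = ∑_{i=1}^N u(…, x_i - 1, …; t) - N·u(X; t)`;
that is, `u` solves the free evolution equation of the `N`-particle totally
asymmetric zero range process. -/
theorem bethe_free_evolution (q : ℂ) (N : ℕ) (hN : 1 ≤ N) (z : Fin N → ℂ)
    (hz : ∀ i, z i ≠ 0)
    (hden : ∀ a b : Fin N, a ≠ b → z a - q * z b - (1 - q) * z a * z b ≠ 0)
    (u : (Fin N → ℤ) → ℝ → ℂ)
    (hu : ∀ (X : Fin N → ℤ) (t : ℝ),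
      u X t = ∑ σ : Equiv.Perm (Fin N),
        Acoef q σ z *
          ∏ i, z (σ i) ^ (X i) * Complex.exp (((z (σ i))⁻¹ - 1) * t))
    (X : Fin N → ℤ) (t : ℝ) :
    HasDerivAt (u X)
      ((∑ i : Fin N, u (Function.update X i (X i - 1)) t) - (N : ℂ) * u X t) t := by
  rw [funext (hu X)]
  have hderiv := HasDerivAt.fun_sum (u := univ) fun (σ : Equiv.Perm (Fin N)) _ =>
    (hasDerivAt_prod_planeWave (fun i => z (σ i)) X t).const_mul (Acoef q σ z)
  refine hderiv.congr_deriv (Eq.symm ?_)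
  simp only [hu]
  rw [sum_comm, mul_sum, ← sum_sub_distrib]
  refine sum_congr rfl fun σ _ => ?_
  have hshift (i : Fin N) := prod_planeWave_update (fun j => z (σ j)) (fun j => hz (σ j)) X
    (fun j => Complex.exp (((z (σ j))⁻¹ - 1) * t)) i
  beta_reduce at hshift
  simp only [hshift]
  rw [← mul_sum, ← sum_mul, sum_sub_distrib, sum_const, card_univ, Fintype.card_fin,
    nsmul_eq_mul, mul_one]
  ring
end

section
/- Let N ≥ 2, let q ∈ ℂ with [k]_q ≠ 0 for all 1 ≤ k ≤ N, and let z_1, …, z_N ∈ ℂ satisfy ∏_{j∈S} z_j ≠ 1 for every nonempty subset S ⊆ {1, …, N}. For 1 ≤ i ≤ N-1, let T_i : S_N → S_N be defined by (T_i σ)(N-i) = σ(N-i+1), (T_i σ)(N-i+1) = σ(N-i), and (T_i σ)(k) = σ(k) for k ≠ N-i, N-i+1, and let T_0 be the identity. Fix σ ∈ S_N. Then, after substituting z_{σ(N)} = 0, one has ∑_{i=0}^{N-1} q^i F^{(N)}_{(T_i ⋯ T_1 T_0)σ} |_{z_{σ(N)}=0} = F^{(N-1)}_{σ'}, where σ'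 : {1, …, N-1} → {1, …, N} ∖ {σ(N)} is given by σ'(i) = σ(i), and F^{(N-1)}_{σ'} is defined analogously in the N-1 variables z_{σ'(1)}, …, z_{σ'(N-1)}, i.e., F^{(N-1)}_{σ'} = (1 - z_{σ'(1)} ⋯ z_{σ'(N-1)})^{-1} ∑_{(m_1,…,m_n)} ([m_1]_q! ⋯ [m_n]_q!)^{-1} t^{σ'}_{m_1} ⋯ t^{σ'}_{m_1+⋯+m_{n-1}} with t^{σ'}_i = (z_{σ'(1)} ⋯ z_{σ'(N-1-i)})/(1 - z_{σ'(1)} ⋯ z_{σ'(N-1-i)}) and the sum over all compositions of N-1. -/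
open Finset

/-- Product of the first `m` entries (in order) of `w : Fin n → ℂ`. -/
noncomputable def prodFirst {n : ℕ} (w : Fin n → ℂ) (m : ℕ) : ℂ :=
  ∏ l ∈ Finset.univ.filter (fun l : Fin n => (l : ℕ) < m), w l

/-- `t_i = (w_1 ⋯ w_{n-i}) / (1 - w_1 ⋯ w_{n-i})`. -/
noncomputable def tF {n : ℕ} (w : Fin n → ℂ) (i : ℕ) : ℂ :=
  prodFirst w (n - i) / (1 - prodFirst w (n - i))

/-- `F^{(n)}` evaluated on the sequence of variables `w = (z_{σ(1)}, …, z_{σ(n)})`: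
`F = (1 - w_1 ⋯ w_n)⁻¹ ∑ ([m_1]_q! ⋯ [m_k]_q!)⁻¹ t_{m_1} t_{m_1+m_2} ⋯`,
the sum over all compositions `(m_1, …, m_k)` of `n`. -/
noncomputable def Ffun (q : ℂ) {n : ℕ} (w : Fin n → ℂ) : ℂ :=
  (1 - ∏ i, w i)⁻¹ *
    ∑ c : Composition n,
      (∏ j, qfact q (c.blocksFun j))⁻¹ *
        ∏ j ∈ Finset.range (c.length - 1), tF w (c.sizeUpTo (j + 1))

namespace Composition

variable {n : ℕ}

/-- Prepend a block of size one. -/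
def consOne (c : Composition n) : Composition (n + 1) where
  blocks := 1 :: c.blocks
  blocks_pos := by
    intro i hi
    rcases List.mem_cons.1 hi with rfl | hi
    · exact one_pos
    · exact c.blocks_pos hi
  blocks_sum := by simp [c.blocks_sum, add_comm]

/-- Enlarge the first block by one. -/
def growHead (c : Composition (n + 1)) : Composition (n + 2) where
  blocks := (c.blocks.headI + 1) :: c.blocks.tail
  blocks_pos := by
    intro i hi
    rcases List.mem_cons.1 hi with rfl | hi
    · exact Nat.succ_pos _
    · exact c.blocks_pos (List.mem_of_mem_tail hi)
  blocks_sum := by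
    have h := c.blocks_sum
    rcases hb : c.blocks with _ | ⟨m, l⟩
    · simp [hb] at h
    · simp [hb] at h ⊢
      omega

lemma exists_blocks_eq_cons (c : Composition (n + 1)) : ∃ m l, c.blocks = m :: l := by
  have h := c.blocks_sum
  rcases hb : c.blocks with _ | ⟨m, l⟩
  · simp [hb] at h
  · exact ⟨m, l, rfl⟩

lemma bijective_elim_consOne_growHead :
    Function.Bijective
      (Sum.elim consOne growHead :
        Composition (n + 1) ⊕ Composition (n + 1) → Composition (n + 2)) := by
  constructor
  · have key : ∀ c d : Composition (n + 1), consOne c ≠ growHead d := by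
      intro c d h
      obtain ⟨m, l, hd⟩ := d.exists_blocks_eq_cons
      have hm : 0 < m := d.blocks_pos (by simp [hd])
      have h' := congrArg Composition.blocks h
      simp only [consOne, growHead, hd, List.headI_cons, List.cons.injEq] at h'
      omega
    rintro (c | c) (d | d) h
    · have h' := congrArg Composition.blocks h
      simp only [Sum.elim_inl, consOne, List.cons.injEq, true_and] at h'
      rw [Composition.ext h']
    · exact (key c d h).elim
    · exact (key d c h.symm).elim
    · obtain ⟨m, l, hc⟩ := c.exists_blocks_eq_cons
      obtain ⟨m', l', hd⟩ := d.exists_blocks_eq_cons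
      have h' := congrArg Composition.blocks h
      simp only [Sum.elim_inr, growHead, hc, hd, List.headI_cons, List.tail_cons,
        List.cons.injEq, Nat.add_right_cancel_iff] at h'
      have hcd : c = d := Composition.ext (by rw [hc, hd, h'.1, h'.2])
      rw [hcd]
  · intro c
    obtain ⟨m, l, hc⟩ := c.exists_blocks_eq_cons
    have hm : 0 < m := c.blocks_pos (by simp [hc])
    have hl : ∀ {i}, i ∈ l → 0 < i := fun hi => c.blocks_pos (by simp [hc, hi])
    have hs : m + l.sum = n + 2 := by simpa [hc] using c.blocks_sum
    rcases Nat.lt_or_ge 1 m with h1 | h1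
    · refine ⟨Sum.inr ⟨(m - 1) :: l, ?_, ?_⟩, ?_⟩
      · intro i hi
        rcases List.mem_cons.1 hi with rfl | hi
        · omega
        · exact hl hi
      · simp only [List.sum_cons]
        omega
      · apply Composition.ext
        simp only [Sum.elim_inr, growHead, List.headI_cons, List.tail_cons, hc]
        rw [Nat.sub_add_cancel hm]
    · obtain rfl : m = 1 := by omega
      exact ⟨Sum.inl ⟨l, hl, by omega⟩, Composition.ext (by simp [consOne, hc])⟩

lemma sum_eq_sum_consOne_add_sum_growHead {M : Type*} [AddCommMonoid M]
    (f : Composition (n + 2) → M) :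
    ∑ c, f c = ∑ c : Composition (n + 1), f c.consOne + ∑ c : Composition (n + 1), f c.growHead := by
  rw [← bijective_elim_consOne_growHead.sum_comp, Fintype.sum_sum_type]
  rfl

end Composition

/-- The summand of `Ffun` attached to the list of blocks `b`, with `t` in place of `tF w`. -/
noncomputable def blockTerm (q : ℂ) (t : ℕ → ℂ) (b : List ℕ) : ℂ :=
  (b.map (qfact q)).prod⁻¹ * ∏ j ∈ Finset.range (b.length - 1), t (b.take (j + 1)).sum

lemma blockTerm_blocks (q : ℂ) (t : ℕ → ℂ) {n : ℕ} (c : Composition n) :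
    blockTerm q t c.blocks = (∏ j, qfact q (c.blocksFun j))⁻¹ *
      ∏ j ∈ Finset.range (c.length - 1), t (c.sizeUpTo (j + 1)) := by
  rw [blockTerm, ← List.prod_ofFn]
  congr 3
  rw [← Function.comp_def (qfact q) c.blocksFun, ← List.map_ofFn, c.ofFn_blocksFun]

lemma qnum_one (q : ℂ) : qnum q 1 = 1 := by simp [qnum]

lemma qfact_one (q : ℂ) : qfact q 1 = 1 := by simp [qfact, qnum_one]

lemma qfact_succ (q : ℂ) (m : ℕ) : qfact q (m + 1) = qfact q m * qnum q (m + 1) :=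
  Finset.prod_range_succ _ _

lemma blockTerm_one_cons (q : ℂ) (t : ℕ → ℂ) (m : ℕ) (l : List ℕ) :
    blockTerm q t (1 :: m :: l) = t 1 * blockTerm q (fun k => t (k + 1)) (m :: l) := by
  simp only [blockTerm, List.map_cons, List.prod_cons, qfact_one, one_mul, List.length_cons,
    Nat.add_sub_cancel, Finset.prod_range_succ' _ l.length, List.take_succ_cons, List.sum_cons,
    List.take_zero, List.sum_nil, add_comm 1]
  ring

lemma qnum_mul_blockTerm_succ_cons {q : ℂ} (t : ℕ → ℂ) {m : ℕ} (l : List ℕ)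
    (hm : qnum q (m + 1) ≠ 0) :
    qnum q (m + 1) * blockTerm q t ((m + 1) :: l) =
      blockTerm q (fun k => t (k + 1)) (m :: l) := by
  simp only [blockTerm, List.map_cons, List.prod_cons, qfact_succ, List.length_cons,
    Nat.add_sub_cancel, List.take_succ_cons, List.sum_cons, mul_inv, add_right_comm m]
  field_simp

lemma sum_qnum_mul_blockTerm {q : ℂ} {n : ℕ} (hq : ∀ k, 1 ≤ k → k ≤ n + 2 → qnum q k ≠ 0)
    (t : ℕ → ℂ) :
    ∑ c : Composition (n + 2), qnum q (c.sizeUpTo 1) * blockTerm q t c.blocks =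
      (1 + t 1) * ∑ c : Composition (n + 1), blockTerm q (fun k => t (k + 1)) c.blocks := by
  rw [Composition.sum_eq_sum_consOne_add_sum_growHead, add_mul, one_mul, add_comm,
    Finset.mul_sum]
  congr 1 <;> refine Finset.sum_congr rfl fun c _ => ?_
  · obtain ⟨m, l, hc⟩ := c.exists_blocks_eq_cons
    have hs : m + l.sum = n + 1 := by simpa [hc] using c.blocks_sum
    simpa [Composition.growHead, Composition.sizeUpTo, hc] using
      qnum_mul_blockTerm_succ_cons t l (hq (m + 1) (by omega) (by omega))
  · obtain ⟨m, l, hc⟩ := c.exists_blocks_eq_cons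
    simp [Composition.consOne, Composition.sizeUpTo, hc, qnum_one, blockTerm_one_cons]

/-- If `t'` agrees with `t` beyond `i` and vanishes up to `i`, only compositions whose first block
exceeds `i` contribute. -/
lemma blockTerm_eq_ite {q : ℂ} {n i : ℕ} (hi : i < n) {t t' : ℕ → ℂ}
    (h0 : ∀ k, 1 ≤ k → k ≤ i → t' k = 0) (h1 : ∀ k, i < k → k < n → t' k = t k)
    (c : Composition n) :
    blockTerm q t' c.blocks = if i < c.sizeUpTo 1 then blockTerm q t c.blocks else 0 := by
  have hlen : 0 < c.length := c.length_pos_of_pos (by omega)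
  split_ifs with h
  · rw [blockTerm, blockTerm]
    congr 1
    refine Finset.prod_congr rfl fun j hj => ?_
    have hj' : j + 1 < c.length := by
      have : j < c.length - 1 := Finset.mem_range.1 hj
      omega
    have hlt : c.sizeUpTo (j + 1) < n :=
      (c.sizeUpTo_strict_mono hj').trans_le (c.sizeUpTo_le _)
    exact h1 _ (h.trans_le (c.monotone_sizeUpTo (by omega))) hlt
  · have h2 : 1 < c.length := by
      by_contra h2
      have := c.sizeUpTo_ofLength_le 1 (by omega)
      omega
    rw [blockTerm]
    refine mul_eq_zero_of_right _ (Finset.prod_eq_zero (i := 0) ?_ ?_)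
    · exact Finset.mem_range.2 (Nat.sub_pos_of_lt h2)
    · refine h0 _ ?_ (not_lt.1 h)
      have := c.sizeUpTo_strict_mono hlen
      rw [c.sizeUpTo_zero] at this
      exact this

lemma sum_pow_mul_ite (q x : ℂ) {m n : ℕ} (h : m ≤ n) :
    ∑ i ∈ Finset.range n, q ^ i * (if i < m then x else 0) = qnum q m * x := by
  simp only [qnum, Finset.sum_mul, mul_ite, mul_zero]
  rw [← Finset.sum_filter]
  refine Finset.sum_congr ?_ fun _ _ => rfl
  ext i
  simp only [Finset.mem_filter, Finset.mem_range]
  omega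

lemma prodFirst_self {n : ℕ} (w : Fin n → ℂ) : prodFirst w n = ∏ i, w i := by
  simp [prodFirst]

lemma prodFirst_eq_zero {n m : ℕ} {w : Fin n → ℂ} (l : Fin n) (hl : (l : ℕ) < m) (h : w l = 0) :
    prodFirst w m = 0 :=
  Finset.prod_eq_zero (i := l) (by simp [hl]) h

lemma prodFirst_eq_of_castSucc {n m : ℕ} (hm : m ≤ n) {w : Fin (n + 1) → ℂ} {a : Fin n → ℂ}
    (h : ∀ l : Fin n, (l : ℕ) < m → w l.castSucc = a l) : prodFirst w m = prodFirst a m := by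
  rw [prodFirst, prodFirst, Finset.prod_filter, Finset.prod_filter, Fin.prod_univ_castSucc]
  rw [if_neg (by simpa using hm), mul_one]
  refine Finset.prod_congr rfl fun l _ => ?_
  simp only [Fin.val_castSucc]
  split_ifs with hl
  · exact h l hl
  · rfl

/-- The recursion for the sequences `w i` obtained from `a` by inserting `0` before the last
`i` entries. -/
lemma sum_pow_mul_Ffun {q : ℂ} {n : ℕ} (hq : ∀ k, 1 ≤ k → k ≤ n + 2 → qnum q k ≠ 0)
    {a : Fin (n + 1) → ℂ} (ha : ∏ i, a i ≠ 1) {w : ℕ → Fin (n + 2) → ℂ}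
    (hw0 : ∀ i ≤ n + 1, w i ⟨n + 1 - i, by omega⟩ = 0)
    (hw : ∀ i ≤ n + 1, ∀ l : Fin (n + 1), (l : ℕ) < n + 1 - i → w i l.castSucc = a l) :
    ∑ i ∈ Finset.range (n + 2), q ^ i * Ffun q (w i) = Ffun q a := by
  set t : ℕ → ℂ := fun k => prodFirst a (n + 2 - k) / (1 - prodFirst a (n + 2 - k)) with ht
  have hF : ∀ i ∈ Finset.range (n + 2), q ^ i * Ffun q (w i) =
      ∑ c : Composition (n + 2),
        q ^ i * (if i < c.sizeUpTo 1 then blockTerm q t c.blocks else 0) := by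
    intro i hi
    have hi : i < n + 2 := Finset.mem_range.1 hi
    rw [Ffun, Finset.prod_eq_zero (Finset.mem_univ _) (hw0 i (by omega)), sub_zero, inv_one,
      one_mul, Finset.mul_sum]
    refine Finset.sum_congr rfl fun c _ => ?_
    rw [← blockTerm_blocks, blockTerm_eq_ite hi (t := t)]
    · intro k hk hki
      rw [tF, prodFirst_eq_zero _ _ (hw0 i (by omega)), zero_div]
      simp only
      omega
    · intro k hik hk
      rw [tF, prodFirst_eq_of_castSucc (by omega)
        fun l hl => hw i (by omega) l (by omega)]
  rw [Finset.sum_congr rfl hF, Finset.sum_comm,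
    Finset.sum_congr rfl fun c _ => sum_pow_mul_ite q _ (c.sizeUpTo_le 1),
    sum_qnum_mul_blockTerm hq, Ffun]
  have ht1 : 1 + t 1 = (1 - ∏ i, a i)⁻¹ := by
    have h1 : 1 - ∏ i, a i ≠ 0 := sub_ne_zero.2 ha.symm
    have h2 : prodFirst a (n + 2 - 1) = ∏ i, a i := prodFirst_self a
    simp only [ht, h2]
    field_simp
    ring
  have ht2 : (fun k => t (k + 1)) = tF a := by
    funext k
    simp only [ht, tF, show n + 2 - (k + 1) = n + 1 - k by omega]
  rw [ht1, ht2]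
  simp only [blockTerm_blocks]

/-- Lemma 3.1 of the paper.  Let `N ≥ 2`, `[k]_q ≠ 0` for
`1 ≤ k ≤ N`, and let `z_1, …, z_N` satisfy `∏_{j ∈ S} z_j ≠ 1` for every nonempty
`S ⊆ {1, …, N}`.  Let `T_i` swap the values of a permutation at the (1-based)
positions `N-i` and `N-i+1`, `T_0 = id`, and let `π i = (T_i ⋯ T_1 T_0)σ`
(encoded by the recursion `π 0 = σ`, `π (i+1) = (π i) ∘ swap`).  Then, substituting
`z_{σ(N)} = 0`,
`∑_{i=0}^{N-1} q^i F^{(N)}_{π i} |_{z_{σ(N)}=0} = F^{(N-1)}_{σ'}`,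
where `σ' : {1, …, N-1} → {1, …, N} ∖ {σ(N)}`, `σ'(i) = σ(i)`. -/
theorem F_recursion (N : ℕ) (hN : 2 ≤ N) (q : ℂ)
    (hq : ∀ k, 1 ≤ k → k ≤ N → qnum q k ≠ 0) (z : Fin N → ℂ)
    (hz : ∀ S : Finset (Fin N), S.Nonempty → ∏ j ∈ S, z j ≠ 1)
    (σ : Equiv.Perm (Fin N)) (π : ℕ → Equiv.Perm (Fin N)) (hπ0 : π 0 = σ)
    (hπ : ∀ i : ℕ, i + 1 < N →
      π (i + 1) =
        π i * Equiv.swap (⟨N - 1 - (i + 1), by omega⟩ : Fin N)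
          (⟨N - (i + 1), by omega⟩ : Fin N)) :
    ∑ i ∈ Finset.range N,
        q ^ i * Ffun q ((Function.update z (σ ⟨N - 1, by omega⟩) 0) ∘ (π i))
      = Ffun q (fun i : Fin (N - 1) => z (σ (Fin.castLE (Nat.sub_le N 1) i))) := by
  obtain ⟨n, rfl⟩ : ∃ n, N = n + 2 := ⟨N - 2, by omega⟩
  have hpos : ∀ i, ∀ hi : i ≤ n + 1,
      π i ⟨n + 1 - i, by omega⟩ = σ (Fin.last (n + 1)) ∧
        ∀ l : Fin (n + 2), (l : ℕ) < n + 1 - i → π i l = σ l := by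
    intro i
    induction i with
    | zero => exact fun _ => ⟨by rw [hπ0]; rfl, fun l _ => by rw [hπ0]⟩
    | succ i ih =>
      intro hi
      obtain ⟨h1, h2⟩ := ih (by omega)
      rw [hπ i (by omega)]
      constructor
      · rw [Equiv.Perm.mul_apply, ← h1]
        refine congrArg (π i) ((Equiv.swap_apply_left _ _).trans ?_)
        ext
        simp only
        omega
      · intro l hl
        rw [Equiv.Perm.mul_apply, Equiv.swap_apply_of_ne_of_ne, h2 l (by omega)]
        · intro h
          have := congrArg Fin.val h
          simp only at this
          omega
        · intro h
          have := congrArg Fin.val h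
          simp only at this
          omega
  refine sum_pow_mul_Ffun hq (a := fun i : Fin (n + 1) => z (σ i.castSucc)) ?_ ?_ ?_
  · have := hz (Finset.univ.map (Fin.castSuccEmb.trans σ.toEmbedding))
      ((Finset.map_nonempty).2 Finset.univ_nonempty)
    rw [Finset.prod_map] at this
    exact this
  · intro i hi
    rw [Function.comp_apply, (hpos i hi).1]
    exact Function.update_self _ _ _
  · intro i hi l hl
    rw [Function.comp_apply, (hpos i hi).2 _ hl]
    refine Function.update_of_ne (fun h => ?_) _ _
    have := congrArg Fin.val (σ.injective h)
    simp only [Fin.val_castSucc] at this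
    omega
end

section
/- Let q ∈ ℂ with q ≠ 0 and q ≠ 1, let N ≥ 1, and let z_1, …, z_N ∈ ℂ satisfy z_i ≠ 0 and z_i ≠ 1 for all i, and z_i - q z_j - (1-q) z_i z_j ≠ 0 for all i ≠ j. Then det(1/(z_i - q z_j - (1-q) z_i z_j))_{1 ≤ i,j ≤ N} = (q^{N(N-1)/2}/(1-q)^N) · (1/∏_{i=1}^N z_i (1 - z_i)) · ∏_{i ≠ j} (z_i - z_j)/(z_i - q z_j - (1-q) z_i z_j). -/
open Finset

namespace Matrix

/-- Gaussian elimination of the first column, using the top left entry as pivot. -/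
theorem det_succ_eq_mul_det_schur {K : Type*} [Field K] {n : ℕ}
    (A : Matrix (Fin (n + 1)) (Fin (n + 1)) K) (h : A 0 0 ≠ 0) :
    A.det = A 0 0 * det (of fun i j : Fin n =>
      A i.succ j.succ - A i.succ 0 * (A 0 0)⁻¹ * A 0 j.succ) := by
  let B : Matrix (Fin (n + 1)) (Fin (n + 1)) K := of fun i j =>
    A i j - (Fin.cons 0 fun k : Fin n => A k.succ 0 * (A 0 0)⁻¹ : Fin (n + 1) → K) i * A 0 j
  have hAB : A.det = B.det := by
    refine det_eq_of_forall_row_eq_smul_add_const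
      (Fin.cons 0 fun k : Fin n => A k.succ 0 * (A 0 0)⁻¹) 0 (by simp) fun i j => ?_
    simp [B]
  rw [hAB, det_succ_column_zero, Fin.sum_univ_succ, Finset.sum_eq_zero fun i _ => ?_]
  · simp only [Fin.val_zero, pow_zero, one_mul, add_zero]
    congr 1
    simp [B]
  · simp [B, h]

end Matrix

theorem Finset.prod_offDiag_univ_fin_succ {M : Type*} [CommMonoid M] {n : ℕ}
    (g : Fin (n + 1) → Fin (n + 1) → M) :
    ∏ p ∈ (univ : Finset (Fin (n + 1))).offDiag, g p.1 p.2 =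
      (∏ i : Fin n, g i.succ 0 * g 0 i.succ) *
        ∏ p ∈ (univ : Finset (Fin n)).offDiag, g p.1.succ p.2.succ := by
  have key (m : ℕ) (g : Fin m → Fin m → M) :
      ∏ p ∈ (univ : Finset (Fin m)).offDiag, g p.1 p.2 =
        ∏ i, ∏ j, if i ≠ j then g i j else 1 := by
    rw [← Fintype.prod_prod_type' (f := fun i j => if i ≠ j then g i j else 1),
      ← Finset.prod_filter]
    congr 1
    ext p
    simp
  rw [key, key n fun i j => g i.succ j.succ]
  simp only [Fin.prod_univ_succ, prod_mul_distrib]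
  simp [Fin.succ_ne_zero, (Fin.succ_ne_zero _).symm, mul_assoc]

/-- The case of arbitrary fields, with the exponent written as a binomial coefficient. -/
theorem det_inv_sub_mul_sub_mul {K : Type*} [Field K] (q : K) (n : ℕ) (z : Fin n → K)
    (hden : ∀ i j, z i - q * z j - (1 - q) * z i * z j ≠ 0) :
    Matrix.det (Matrix.of fun i j : Fin n => (z i - q * z j - (1 - q) * z i * z j)⁻¹) =
      q ^ n.choose 2 / (1 - q) ^ n * (∏ i, z i * (1 - z i))⁻¹ *
        ∏ p ∈ univ.offDiag,
          (z p.1 - z p.2) / (z p.1 - q * z p.2 - (1 - q) * z p.1 * z p.2) := by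
  induction n with
  | zero => simp
  | succ n ih =>
    have schur_entry (i j : Fin n) :
        (z i.succ - q * z j.succ - (1 - q) * z i.succ * z j.succ)⁻¹ -
          (z i.succ - q * z 0 - (1 - q) * z i.succ * z 0)⁻¹ *
            ((z 0 - q * z 0 - (1 - q) * z 0 * z 0)⁻¹)⁻¹ *
            (z 0 - q * z j.succ - (1 - q) * z 0 * z j.succ)⁻¹ =
        (q * (z i.succ - z 0) / (z i.succ - q * z 0 - (1 - q) * z i.succ * z 0)) *
          ((z 0 - z j.succ) / (z 0 - q * z j.succ - (1 - q) * z 0 * z j.succ) *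
            (z i.succ - q * z j.succ - (1 - q) * z i.succ * z j.succ)⁻¹) := by
      have h₁ := hden i.succ j.succ
      have h₂ := hden i.succ 0
      have h₃ := hden 0 j.succ
      rw [inv_inv, div_eq_mul_inv, div_eq_mul_inv]
      generalize hu : z i.succ - q * z j.succ - (1 - q) * z i.succ * z j.succ = u at *
      generalize hv : z i.succ - q * z 0 - (1 - q) * z i.succ * z 0 = v at *
      generalize hw : z 0 - q * z j.succ - (1 - q) * z 0 * z j.succ = w at *
      field_simp
      rw [← hu, ← hv, ← hw]
      ring
    rw [Matrix.det_succ_eq_mul_det_schur _ (by simpa using hden 0 0)]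
    simp only [Matrix.of_apply, schur_entry]
    have scaled := Matrix.det_mul_column
      (fun i : Fin n => q * (z i.succ - z 0) / (z i.succ - q * z 0 - (1 - q) * z i.succ * z 0))
      (Matrix.of fun i j : Fin n =>
        (z 0 - z j.succ) / (z 0 - q * z j.succ - (1 - q) * z 0 * z j.succ) *
          (z i.succ - q * z j.succ - (1 - q) * z i.succ * z j.succ)⁻¹)
    have scaled' := Matrix.det_mul_row
      (fun j : Fin n => (z 0 - z j.succ) / (z 0 - q * z j.succ - (1 - q) * z 0 * z j.succ))
      (Matrix.of fun i j : Fin n =>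
        (z i.succ - q * z j.succ - (1 - q) * z i.succ * z j.succ)⁻¹)
    simp only [Matrix.of_apply] at scaled scaled'
    rw [scaled, scaled', ih (fun i => z i.succ) fun i j => hden _ _,
      Finset.prod_offDiag_univ_fin_succ fun i j =>
        (z i - z j) / (z i - q * z j - (1 - q) * z i * z j),
      Fin.prod_univ_succ, Nat.choose_succ_succ' n 1, Nat.choose_one_right, pow_add,
      pow_succ (1 - q),
      show z 0 - q * z 0 - (1 - q) * z 0 * z 0 = (1 - q) * (z 0 * (1 - z 0)) by ring]
    simp only [prod_mul_distrib, prod_const, card_univ, Fintype.card_fin, mul_inv,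
      div_eq_mul_inv]
    ring

/-- Let `q ∈ ℂ` with `q ≠ 0`, `q ≠ 1`, `N ≥ 1`, and let
`z_1, …, z_N ∈ ℂ` satisfy `z_i ≠ 0`, `z_i ≠ 1` and
`z_i - q z_j - (1-q) z_i z_j ≠ 0` for `i ≠ j`.  Then
`det(1/(z_i - q z_j - (1-q) z_i z_j))
  = (q^{N(N-1)/2}/(1-q)^N) · (1/∏_i z_i(1-z_i)) ·
    ∏_{i≠j} (z_i - z_j)/(z_i - q z_j - (1-q) z_i z_j)`. -/
theorem cauchy_type_determinant (q : ℂ) (hq0 : q ≠ 0) (hq1 : q ≠ 1)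
    (N : ℕ) (hN : 1 ≤ N) (z : Fin N → ℂ)
    (hz0 : ∀ i, z i ≠ 0) (hz1 : ∀ i, z i ≠ 1)
    (hden : ∀ i j, i ≠ j → z i - q * z j - (1 - q) * z i * z j ≠ 0) :
    Matrix.det (Matrix.of fun i j : Fin N =>
        (z i - q * z j - (1 - q) * z i * z j)⁻¹)
      = q ^ (N * (N - 1) / 2) / (1 - q) ^ N *
          (∏ i, z i * (1 - z i))⁻¹ *
          ∏ p ∈ Finset.univ.offDiag,
            (z p.1 - z p.2) / (z p.1 - q * z p.2 - (1 - q) * z p.1 * z p.2) := by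
  have diag (i : Fin N) : z i - q * z i - (1 - q) * z i * z i ≠ 0 := by
    rw [show z i - q * z i - (1 - q) * z i * z i = (1 - q) * (z i * (1 - z i)) by ring]
    exact mul_ne_zero (sub_ne_zero.2 hq1.symm)
      (mul_ne_zero (hz0 i) (sub_ne_zero.2 (hz1 i).symm))
  rw [← Nat.choose_two_right]
  refine det_inv_sub_mul_sub_mul q N z fun i j => ?_
  obtain rfl | hij := eq_or_ne i j
  exacts [diag i, hden i j hij]
end
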